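/- Let f, g : closure(U) → ℂ^n be continuous maps, holomorphic on a bounded domain U ⊂ ℂ^n with smooth Jordan boundary ∂U, such that ‖f(x)‖ > ‖g(x)‖ for every x ∈ ∂U (Euclidean norm). If f has a zero in U, then f + g has a zero in U. -/

import Mathlib

open Set Metric Filter Topology MeasureTheory

theorem osg_aux {E F : Type*} [NormedAddCommGroup E] [NormedSpace ℂ E] [FiniteDimensional ℂ E]
    [NormedAddCommGroup F] [NormedSpace ℂ F] [FiniteDimensional ℂ F]
    {U : Set E} (hU : IsOpen U) {f : E → F} (hf : DifferentiableOn ℂ f U) (v : E) :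
    DifferentiableOn ℂ (fun x => fderiv ℂ f x v) U := by
  intro x₀ hx₀
  have : ProperSpace E := FiniteDimensional.proper ℂ E
  have : CompleteSpace F := FiniteDimensional.complete ℂ F
  let _ : MeasurableSpace E := borel E
  have : BorelSpace E := ⟨rfl⟩
  obtain ⟨ε, hε, hεU⟩ := Metric.isOpen_iff.1 hU x₀ hx₀
  obtain ⟨R, hR, hRε⟩ : ∃ R : ℝ, 0 < R ∧ 3 * R < ε := ⟨ε / 4, by positivity, by linarith⟩
  have hcU : closedBall x₀ (3 * R) ⊆ U := (closedBall_subset_ball hRε).trans hεU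
  obtain ⟨M, hM⟩ := (isCompact_closedBall x₀ (3 * R)).exists_bound_of_continuousOn
    (hf.continuousOn.mono hcU)
  have hbd : ∀ y ∈ closedBall x₀ (2 * R), ‖fderiv ℂ f y‖ ≤ (2 * M) / R := by
    intro y hy
    have hsub : ball y R ⊆ closedBall x₀ (3 * R) := by
      intro z hz
      rw [mem_ball] at hz
      rw [mem_closedBall] at hy ⊢
      linarith [dist_triangle z y x₀]
    apply Complex.norm_fderiv_le_div_of_mapsTo_ball (hf.mono (hsub.trans hcU)) _ hR
    intro z hz
    rw [mem_closedBall, dist_eq_norm]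
    linarith [norm_sub_le (f z) (f y), hM z (hsub hz), hM y (hsub (mem_ball_self hR))]
  obtain ⟨r, hr, hrv⟩ : ∃ r : ℝ, 0 < r ∧ r * ‖v‖ ≤ R := by
    refine ⟨R / (‖v‖ + 1), by positivity, ?_⟩
    rw [div_mul_eq_mul_div, div_le_iff₀ (by positivity)]
    nlinarith [norm_nonneg v]
  have hmem : ∀ x ∈ ball x₀ R, ∀ z : ℂ, ‖z‖ ≤ r → x + z • v ∈ closedBall x₀ (2 * R) := by
    intro x hx z hz
    rw [mem_ball, dist_eq_norm] at hx
    rw [mem_closedBall, dist_eq_norm]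
    calc ‖x + z • v - x₀‖ = ‖(x - x₀) + z • v‖ := by congr 1; abel
      _ ≤ ‖x - x₀‖ + ‖z‖ * ‖v‖ := by rw [← norm_smul]; exact norm_add_le _ _
      _ ≤ R + R := add_le_add hx.le ((mul_le_mul_of_nonneg_right hz (norm_nonneg _)).trans hrv)
      _ = 2 * R := by ring
  have h2U : closedBall x₀ (2 * R) ⊆ U := (closedBall_subset_closedBall (by linarith)).trans hcU
  have hda : ∀ y ∈ U, DifferentiableAt ℂ f y := fun y hy => (hf y hy).differentiableAt (hU.mem_nhds hy)
  -- coefficient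
  let c : ℝ → ℂ := fun θ => deriv (circleMap 0 r) θ * ((circleMap 0 r θ - 0) ^ 2)⁻¹
  have hcne : ∀ θ, circleMap 0 r θ ≠ 0 := fun θ => by
    exact circleMap_ne_center (c := 0) (θ := θ) hr.ne'
  have hcc : Continuous c := by
    apply Continuous.mul
    · have h0 : deriv (circleMap 0 r) = fun θ => circleMap 0 r θ * Complex.I :=
        funext fun θ => by simp
      rw [h0]; fun_prop
    · apply Continuous.inv₀
      · fun_prop
      · intro θ; simpa using hcne θ
  have hcz : ∀ θ, ‖circleMap 0 r θ‖ ≤ r := fun θ => by simp [abs_of_pos hr]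
  have key : ∀ x ∈ ball x₀ R, fderiv ℂ f x v =
      (2 * Real.pi * Complex.I : ℂ)⁻¹ • ∫ θ in (0:ℝ)..2 * Real.pi,
        c θ • f (x + circleMap 0 r θ • v) := by
    intro x hx
    have hV : IsOpen {z : ℂ | x + z • v ∈ U} := hU.preimage (by fun_prop)
    have hg : DifferentiableOn ℂ (fun z : ℂ => f (x + z • v)) {z : ℂ | x + z • v ∈ U} :=
      hf.comp (by fun_prop) (fun z hz => hz)
    have h1 := Complex.cderiv_eq_deriv hV hg hr (z := 0)
      (fun z hz => h2U (hmem x hx z (by simpa using hz)))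
    have h2 : deriv (fun z : ℂ => f (x + z • v)) 0 = fderiv ℂ f x v := by
      have hxU : x ∈ U := by simpa using h2U (hmem x hx 0 (by simpa using hr.le))
      have h3 : HasFDerivAt f (fderiv ℂ f x) (x + (0:ℂ) • v) := by
        simpa using (hda x hxU).hasFDerivAt
      have h4 : HasDerivAt (fun z : ℂ => x + z • v) v 0 := by
        simpa using ((hasDerivAt_id (0:ℂ)).smul_const v).const_add x
      exact (h3.comp_hasDerivAt (0:ℂ) h4).deriv
    rw [← h2, ← h1, Complex.cderiv, circleIntegral]
    simp only [c, smul_smul]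
  have hcont : ∀ x ∈ ball x₀ R, Continuous (fun θ => c θ • f (x + circleMap 0 r θ • v)) := by
    intro x hx
    apply hcc.smul
    apply (hf.continuousOn.mono h2U).comp_continuous (by fun_prop)
    intro θ
    exact hmem x hx _ (hcz θ)
  have hD := intervalIntegral.hasFDerivAt_integral_of_dominated_of_fderiv_le (𝕜 := ℂ)
    (μ := volume) (a := 0) (b := 2 * Real.pi) (s := ball x₀ R) (x₀ := x₀)
    (F := fun x θ => c θ • f (x + circleMap 0 r θ • v))
    (F' := fun x θ => c θ • fderiv ℂ f (x + circleMap 0 r θ • v))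
    (bound := fun θ => ‖c θ‖ * (2 * M / R))
    (ball_mem_nhds _ hR)
    (by
      filter_upwards [ball_mem_nhds x₀ hR] with x hx
      exact (hcont x hx).aestronglyMeasurable)
    ((hcont x₀ (mem_ball_self hR)).intervalIntegrable _ _)
    (by
      have hme : Measurable fun θ => fderiv ℂ f (x₀ + circleMap 0 r θ • v) :=
        (measurable_fderiv ℂ f).comp (by fun_prop)
      have : FiniteDimensional ℂ (E →L[ℂ] F) := inferInstance
      have : ProperSpace (E →L[ℂ] F) := FiniteDimensional.proper ℂ _
      exact (hcc.measurable.smul hme).stronglyMeasurable.aestronglyMeasurable)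
    (by
      refine Eventually.of_forall fun θ _ x hx => ?_
      rw [norm_smul]
      exact mul_le_mul_of_nonneg_left (hbd _ (hmem x hx _ (hcz θ))) (norm_nonneg _))
    ((hcc.norm.mul continuous_const).intervalIntegrable _ _)
    (by
      refine Eventually.of_forall fun θ _ x hx => ?_
      have h3 := (hda _ (h2U (hmem x hx _ (hcz θ)))).hasFDerivAt
      have h4 : HasFDerivAt (fun x => x + circleMap 0 r θ • v) (ContinuousLinearMap.id ℂ E) x :=
        (hasFDerivAt_id x).add_const _
      exact (h3.comp x h4).const_smul (c θ))
  apply DifferentiableAt.differentiableWithinAt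
  refine ((hD.differentiableAt).const_smul ((2 * Real.pi * Complex.I : ℂ)⁻¹)).congr_of_eventuallyEq ?_
  filter_upwards [ball_mem_nhds x₀ hR] with x hx
  exact key x hx

theorem osg {E F : Type*} [NormedAddCommGroup E] [NormedSpace ℂ E] [FiniteDimensional ℂ E]
    [NormedAddCommGroup F] [NormedSpace ℂ F] [FiniteDimensional ℂ F]
    {U : Set E} (hU : IsOpen U) (n : ℕ) : ∀ {f : E → F}, DifferentiableOn ℂ f U →
    ContDiffOn ℂ n f U := by
  induction n with
  | zero => intro f hf; exact_mod_cast contDiffOn_zero.2 hf.continuousOn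
  | succ n ih =>
    intro f hf
    have := (contDiffOn_succ_iff_fderiv_of_isOpen (n := (n : WithTop ℕ∞)) (𝕜 := ℂ) (f := f) hU).2
      ⟨hf, by simp, contDiffOn_clm_apply.2 fun v => ih (osg_aux hU hf v)⟩
    exact_mod_cast this


section degree
variable {E ι : Type*} [NormedAddCommGroup E] [NormedSpace ℝ E] [FiniteDimensional ℝ E]
  [Fintype ι] [DecidableEq ι] (e : Module.Basis ι ℝ E)

theorem cramer_basis (a : ι → E) (v : E) :
    ∑ i, e.det (Function.update a i v) • a i = e.det a • v := by
  apply e.ext_elem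
  intro k
  have h := congrFun (Matrix.mulVec_cramer (e.toMatrix a) (e.repr v)) k
  simp only [Matrix.mulVec, dotProduct, Matrix.cramer_apply, ← Module.Basis.toMatrix_update,
    ← Module.Basis.det_apply, Pi.smul_apply, smul_eq_mul, Module.Basis.toMatrix_apply] at h
  simp only [map_sum, map_smul, Finsupp.coe_finsetSum, Finset.sum_apply, Finsupp.smul_apply,
    smul_eq_mul]
  rw [← h]
  exact Finset.sum_congr rfl fun i _ => mul_comm _ _

theorem alg_id (a : ι → E) (v : E) (s : ι → ι → E) (hs : ∀ i j, s i j = s j i) (γ : ι → E)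
    (l : E →L[ℝ] ℝ) (c : ℝ) :
    ∑ i, (l (a i) * e.det (Function.update a i v) +
      c * ∑ j, e.det (Function.update (Function.update a i v) j (if j = i then γ i else s i j)))
    = l v * e.det a + c * ∑ i, e.det (Function.update a i (γ i)) := by
  rw [Finset.sum_add_distrib]
  congr 1
  · have := congrArg l (cramer_basis e a v)
    simp only [map_sum, map_smul, smul_eq_mul] at this
    rw [mul_comm, ← this]
    exact Finset.sum_congr rfl fun i _ => mul_comm _ _
  · rw [← Finset.mul_sum]
    congr 1
    have h1 : ∀ i j, e.det (Function.update (Function.update a i v) j (if j = i then γ i else s i j))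
        = (if j = i then e.det (Function.update a i (γ i)) else 0) +
          (if j = i then 0 else e.det (Function.update (Function.update a i v) j (s i j))) := by
      intro i j
      by_cases h : j = i
      · subst h; simp
      · simp [h]
    simp only [h1, Finset.sum_add_distrib, Finset.sum_ite_eq', Finset.mem_univ, if_true]
    rw [add_eq_left]
    set S := ∑ i, ∑ j, (if j = i then 0 else e.det (Function.update (Function.update a i v) j (s i j)))
      with hS
    have h2 : S = -S := by
      conv_lhs => rw [hS, Finset.sum_comm]
      rw [hS, ← Finset.sum_neg_distrib]
      refine Finset.sum_congr rfl fun i _ => ?_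
      rw [← Finset.sum_neg_distrib]
      refine Finset.sum_congr rfl fun j _ => ?_
      by_cases h : j = i
      · simp [h]
      · have h' : ¬ i = j := fun q => h q.symm
        simp only [h, h', if_false]
        rw [← e.det.map_swap _ h, hs i j]
        congr 1
        ext k
        simp only [Function.comp, Function.update_apply, Equiv.swap_apply_def]
        split_ifs <;> simp_all
    linarith

theorem det_cont : Continuous (fun v : ι → E => e.det v) := by
  simp only [Module.Basis.det_apply]
  apply Continuous.matrix_det
  refine continuous_matrix fun i j => ?_
  simp only [Module.Basis.toMatrix_apply]
  exact (LinearMap.continuous_of_finiteDimensional (e.coord i)).comp (continuous_apply j)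

/-- The determinant as a continuous multilinear map. -/
noncomputable def detC : ContinuousMultilinearMap ℝ (fun _ : ι => E) ℝ :=
  { e.det.toMultilinearMap with cont := det_cont e }

theorem detC_apply (v : ι → E) : detC e v = e.det v := rfl

theorem div_lemma (φ : E → ℝ) (hφ : Differentiable ℝ φ) (h g : E → E) (x : E)
    (hh : ContDiffAt ℝ 2 h x) (hg : DifferentiableAt ℝ g x) :
    ∑ i, fderiv ℝ (fun y => φ (h y) *
        e.det (Function.update (fun j => fderiv ℝ h y (e j)) i (g y))) x (e i) =
    fderiv ℝ φ (h x) (g x) * e.det (fun j => fderiv ℝ h x (e j)) +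
      φ (h x) * ∑ i, e.det (Function.update (fun j => fderiv ℝ h x (e j)) i (fderiv ℝ g x (e i))) := by
  have hd : DifferentiableAt ℝ h x := hh.differentiableAt (by norm_num)
  have hd2 : DifferentiableAt ℝ (fderiv ℝ h) x :=
    (hh.fderiv_right (m := 1) (by norm_num)).differentiableAt (by norm_num)
  have hsymm : IsSymmSndFDerivAt ℝ h x := hh.isSymmSndFDerivAt (by simp)
  rw [← alg_id e (fun j => fderiv ℝ h x (e j)) (g x)
    (fun i j => fderiv ℝ (fderiv ℝ h) x (e i) (e j)) (fun i j => hsymm _ _)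
    (fun i => fderiv ℝ g x (e i)) (fderiv ℝ φ (h x)) (φ (h x))]
  refine Finset.sum_congr rfl fun i _ => ?_
  have h1 : HasFDerivAt (fun y => φ (h y)) ((fderiv ℝ φ (h x)).comp (fderiv ℝ h x)) x :=
    (hφ (h x)).hasFDerivAt.comp x hd.hasFDerivAt
  have h2 := HasFDerivAt.multilinear_comp (f := detC e) (x := x)
    (g := fun j y => Function.update (fun j => fderiv ℝ h y (e j)) i (g y) j)
    (g' := fun j => if j = i then fderiv ℝ g x else (fderiv ℝ (fderiv ℝ h) x).flip (e j))
    (by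
      intro j
      by_cases hj : j = i
      · subst hj; simpa using hg.hasFDerivAt
      · simp only [hj, if_false, Function.update_of_ne, ne_eq, not_false_eq_true]
        have := hd2.hasFDerivAt.clm_apply (hasFDerivAt_const (e j) x)
        simpa using this)
  have h3 : fderiv ℝ (fun y => φ (h y) *
      e.det (Function.update (fun j => fderiv ℝ h y (e j)) i (g y))) x = _ := (h1.mul h2).fderiv
  rw [h3]
  simp only [add_apply, smul_apply,
    ContinuousLinearMap.comp_apply, sum_apply, smul_eq_mul]
  rw [add_comm]
  congr 1
  · rw [mul_comm]; rfl
  · congr 1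
    refine Finset.sum_congr rfl fun j _ => ?_
    rw [ContinuousMultilinearMap.toContinuousLinearMap_apply, detC_apply]
    by_cases hj : j = i
    · subst hj; simp
    · simp [hj]
variable [MeasurableSpace E] [BorelSpace E] (μ : Measure E) [μ.IsAddHaarMeasure]

theorem integral_fderiv_zero (X : E → ℝ) (hX : ContDiff ℝ 1 X) (hc : HasCompactSupport X) (v : E) :
    ∫ x, fderiv ℝ X x v ∂μ = 0 := by
  have hcd : Continuous fun x => fderiv ℝ X x v :=
    (hX.continuous_fderiv (by norm_num)).clm_apply continuous_const
  have hcs : HasCompactSupport fun x => fderiv ℝ X x v := hc.fderiv_apply (𝕜 := ℝ) v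
  have h := integral_smul_fderiv_eq_neg_fderiv_smul_of_integrable (μ := μ) (𝕜 := ℝ)
    (f := fun _ : E => (1:ℝ)) (g := X) (v := v)
    (by simp) (by simpa using hcd.integrable_of_hasCompactSupport hcs)
    (by simpa using hX.continuous.integrable_of_hasCompactSupport hc)
    (by intros; fun_prop) (fun x _ => hX.differentiable (by norm_num) x)
  simpa using h

theorem deg_inv {U K : Set E} (hU : IsOpen U) (hK : IsCompact K) (hKU : K ⊆ U) {f g : E → E}
    (hf : ContDiffOn ℝ 2 f U) (hg : ContDiffOn ℝ 2 g U) {φ : E → ℝ} (hφ : ContDiff ℝ 2 φ)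
    {η : ℝ} (hη : 0 < η)
    (hsupp : ∀ t ∈ Ioo (-η) (1 + η), ∀ x ∈ U, f x + t • g x ∈ tsupport φ → x ∈ K) :
    ∫ x in K, φ (f x) * e.det (fun j => fderiv ℝ f x (e j)) ∂μ =
    ∫ x in K, φ (f x + g x) * e.det (fun j => fderiv ℝ f x (e j) + fderiv ℝ g x (e j)) ∂μ := by
  let P : ℝ → E → ℝ := fun t x => φ (f x + t • g x) *
    e.det (fun j => fderiv ℝ f x (e j) + t • fderiv ℝ g x (e j))
  let P' : ℝ → E → ℝ := fun t x => fderiv ℝ φ (f x + t • g x) (g x) *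
      e.det (fun j => fderiv ℝ f x (e j) + t • fderiv ℝ g x (e j)) +
    φ (f x + t • g x) * ∑ i, e.det (Function.update
      (fun j => fderiv ℝ f x (e j) + t • fderiv ℝ g x (e j)) i (fderiv ℝ g x (e i)))
  have hφd : Differentiable ℝ φ := hφ.differentiable (by norm_num)
  have hderiv : ∀ x t, HasDerivAt (fun t => P t x) (P' t x) t := by
    intro x t
    have h0 : HasDerivAt (fun t : ℝ => f x + t • g x) (g x) t := by
      simpa using ((hasDerivAt_id t).smul_const (g x)).const_add (f x)
    have h1 : HasDerivAt (fun t : ℝ => φ (f x + t • g x)) (fderiv ℝ φ (f x + t • g x) (g x)) t :=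
      (hφd _).hasFDerivAt.comp_hasDerivAt t h0
    have h2 := HasFDerivAt.multilinear_comp (f := detC e) (x := t)
      (g := fun j (t : ℝ) => fderiv ℝ f x (e j) + t • fderiv ℝ g x (e j))
      (g' := fun j => ContinuousLinearMap.toSpanSingleton ℝ (fderiv ℝ g x (e j)))
      (by
        intro j
        have : HasDerivAt (fun t : ℝ => fderiv ℝ f x (e j) + t • fderiv ℝ g x (e j))
            (fderiv ℝ g x (e j)) t := by
          simpa using ((hasDerivAt_id t).smul_const (fderiv ℝ g x (e j))).const_add
            (fderiv ℝ f x (e j))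
        exact this.hasFDerivAt)
    have h3 := h1.mul h2.hasDerivAt
    refine HasDerivAt.congr_deriv h3 ?_
    simp [P', detC_apply, ContinuousMultilinearMap.toContinuousLinearMap_apply]
  have cf := hf.continuousOn
  have cg := hg.continuousOn
  have cdf := hf.continuousOn_fderiv_of_isOpen hU (by norm_num)
  have cdg := hg.continuousOn_fderiv_of_isOpen hU (by norm_num)
  have c2 : ContinuousOn (fun p : ℝ × E => p.2) (univ ×ˢ U) := continuous_snd.continuousOn
  have m2 : MapsTo (fun p : ℝ × E => p.2) (univ ×ˢ U) U := fun p hp => hp.2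
  have ch : ContinuousOn (fun p : ℝ × E => f p.2 + p.1 • g p.2) (univ ×ˢ U) :=
    (cf.comp c2 m2).add (continuous_fst.continuousOn.smul (cg.comp c2 m2))
  have cgj : ∀ j, ContinuousOn (fun p : ℝ × E => fderiv ℝ g p.2 (e j)) (univ ×ˢ U) := fun j =>
    (cdg.comp c2 m2).clm_apply continuousOn_const
  have ca : ∀ j, ContinuousOn (fun p : ℝ × E => fderiv ℝ f p.2 (e j) + p.1 • fderiv ℝ g p.2 (e j))
      (univ ×ˢ U) := fun j =>
    ((cdf.comp c2 m2).clm_apply continuousOn_const).add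
      (continuous_fst.continuousOn.smul (cgj j))
  have cφh : ContinuousOn (fun p : ℝ × E => φ (f p.2 + p.1 • g p.2)) (univ ×ˢ U) :=
    hφ.continuous.comp_continuousOn ch
  have cdet : ContinuousOn (fun p : ℝ × E =>
      e.det (fun j => fderiv ℝ f p.2 (e j) + p.1 • fderiv ℝ g p.2 (e j))) (univ ×ˢ U) :=
    (det_cont e).comp_continuousOn (continuousOn_pi.2 ca)
  have hPc : ContinuousOn (fun p : ℝ × E => P p.1 p.2) (univ ×ˢ U) := cφh.mul cdet
  have hP'c : ContinuousOn (fun p : ℝ × E => P' p.1 p.2) (univ ×ˢ U) := by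
    refine ContinuousOn.add (ContinuousOn.mul ?_ cdet) (ContinuousOn.mul cφh ?_)
    · exact ((hφ.continuous_fderiv (by norm_num)).comp_continuousOn ch).clm_apply (cg.comp c2 m2)
    · refine continuousOn_finsetSum _ fun i _ => ?_
      refine (det_cont e).comp_continuousOn (continuousOn_pi.2 fun j => ?_)
      by_cases hj : j = i
      · subst hj; simpa using cgj j
      · simpa [hj] using ca j
  have hPt : ∀ t, ContinuousOn (P t) K := fun t =>
    hPc.comp (f := fun x => (t, x)) (by fun_prop) (fun x hx => ⟨mem_univ _, hKU hx⟩)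
  have hP't : ∀ t, ContinuousOn (P' t) K := fun t =>
    hP'c.comp (f := fun x => (t, x)) (by fun_prop) (fun x hx => ⟨mem_univ _, hKU hx⟩)
  have hzero : ∀ t ∈ Ioo (-η) (1 + η), ∫ x in K, P' t x ∂μ = 0 := by
    intro t ht
    let h : E → E := fun x => f x + t • g x
    have hh : ContDiffOn ℝ 2 h U := hf.add (contDiffOn_const.smul hg)
    have hda : ∀ x ∈ U, fderiv ℝ h x = fderiv ℝ f x + t • fderiv ℝ g x := by
      intro x hx
      have h1 := (hf.contDiffAt (hU.mem_nhds hx)).differentiableAt (by norm_num)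
      have h2 := (hg.contDiffAt (hU.mem_nhds hx)).differentiableAt (by norm_num)
      exact (h1.hasFDerivAt.add (h2.hasFDerivAt.const_smul t)).fderiv
    let X : ι → E → ℝ := fun i y =>
      φ (h y) * e.det (Function.update (fun j => fderiv ℝ h y (e j)) i (g y))
    have hX1 : ∀ i, ContDiffOn ℝ 1 (X i) U := by
      intro i
      refine ContDiffOn.mul ?_ ?_
      · exact (hφ.of_le (by norm_num)).comp_contDiffOn (hh.of_le (by norm_num))
      · refine (detC e).contDiff.comp_contDiffOn (contDiffOn_pi.2 fun j => ?_)
        by_cases hj : j = i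
        · subst hj; simpa using hg.of_le (by norm_num)
        · simpa [hj] using (hh.fderiv_of_isOpen hU (m := 1) (by norm_num)).clm_apply contDiffOn_const
    let Y : ι → E → ℝ := fun i => K.indicator (X i)
    have hKc : IsOpen Kᶜ := hK.isClosed.isOpen_compl
    have hXz : ∀ i, ∀ x ∈ U, x ∉ K → X i x = 0 := by
      intro i x hx hxK
      have : h x ∉ tsupport φ := fun q => hxK (hsupp t ht x hx q)
      simp [X, image_eq_zero_of_notMem_tsupport this]
    have hYU : ∀ i, ∀ x ∈ U, Y i =ᶠ[𝓝 x] X i := by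
      intro i x hx
      filter_upwards [hU.mem_nhds hx] with y hy
      by_cases hyK : y ∈ K
      · simp [Y, hyK]
      · simp [Y, hyK, hXz i y hy hyK]
    have hYK : ∀ i, ∀ x ∉ K, Y i =ᶠ[𝓝 x] fun _ => 0 := by
      intro i x hx
      filter_upwards [hKc.mem_nhds hx] with y hy
      exact indicator_of_notMem hy _
    have hY1 : ∀ i, ContDiff ℝ 1 (Y i) := by
      intro i
      rw [contDiff_iff_contDiffAt]
      intro x
      by_cases hx : x ∈ U
      · exact ((hX1 i).contDiffAt (hU.mem_nhds hx)).congr_of_eventuallyEq (hYU i x hx)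
      · exact contDiffAt_const.congr_of_eventuallyEq (hYK i x fun q => hx (hKU q))
    have hYs : ∀ i, HasCompactSupport (Y i) := fun i =>
      HasCompactSupport.intro hK fun x hx => indicator_of_notMem hx _
    have hsum : ∀ x, ∑ i, fderiv ℝ (Y i) x (e i) = K.indicator (P' t) x := by
      intro x
      by_cases hx : x ∈ K
      · rw [indicator_of_mem hx]
        simp only [(hYU _ x (hKU hx)).fderiv_eq]
        have := div_lemma e φ hφd h g x (hh.contDiffAt (hU.mem_nhds (hKU hx)))
          ((hg.contDiffAt (hU.mem_nhds (hKU hx))).differentiableAt (by norm_num))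
        rw [this, hda x (hKU hx)]
        rfl
      · rw [indicator_of_notMem hx]
        simp only [(hYK _ x hx).fderiv_eq]
        simp
    rw [← integral_indicator hK.measurableSet]
    simp only [← hsum]
    rw [integral_finsetSum]
    · exact Finset.sum_eq_zero fun i _ => integral_fderiv_zero μ (Y i) (hY1 i) (hYs i) (e i)
    · intro i _
      exact (((hY1 i).continuous_fderiv (by norm_num)).clm_apply
        continuous_const).integrable_of_hasCompactSupport ((hYs i).fderiv_apply (𝕜 := ℝ) (e i))
  have hI : ∀ t ∈ Ioo (-η) (1 + η), HasDerivAt (fun t => ∫ x in K, P t x ∂μ) 0 t := by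
    intro t ht
    rw [← hzero t ht]
    obtain ⟨M, hM⟩ := ((isCompact_closedBall t 1).prod hK).exists_bound_of_continuousOn
      (hP'c.mono (prod_mono (subset_univ _) hKU))
    refine (hasDerivAt_integral_of_dominated_loc_of_deriv_le (μ := μ.restrict K) (F := P) (F' := P')
      (bound := fun _ => M) (closedBall_mem_nhds t one_pos)
      (Eventually.of_forall fun s => (hPt s).aestronglyMeasurable hK.measurableSet)
      ((hPt t).integrableOn_compact hK) ((hP't t).aestronglyMeasurable hK.measurableSet)
      ?_ ?_ ?_).2
    · filter_upwards [ae_restrict_mem hK.measurableSet] with x hx s hs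
      exact hM (s, x) ⟨hs, hx⟩
    · exact integrableOn_const (hK.measure_lt_top.ne)
    · exact Eventually.of_forall fun x s _ => hderiv x s
  have hconst := (convex_Ioo (-η) (1 + η)).is_const_of_fderivWithin_eq_zero (𝕜 := ℝ)
    (f := fun t => ∫ x in K, P t x ∂μ)
    (fun t ht => (hI t ht).differentiableAt.differentiableWithinAt)
    (fun t ht => by
      rw [fderivWithin_of_isOpen isOpen_Ioo ht]
      have := (hI t ht).hasFDerivAt.fderiv
      simpa using this)
    (x := 0) (y := 1) ⟨by linarith, by linarith⟩ ⟨by linarith, by linarith⟩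
  simpa [P] using hconst

end degree

section final
variable {E : Type*} [NormedAddCommGroup E] [NormedSpace ℂ E] [FiniteDimensional ℂ E]

theorem det_eq_normSq {ι : Type*} [Fintype ι] [DecidableEq ι] (e : Module.Basis ι ℝ E)
    (f : E → E) (x : E) (hf : DifferentiableAt ℂ f x) :
    e.det (fun j => fderiv ℝ f x (e j)) =
      Complex.normSq (LinearMap.det (fderiv ℂ f x).toLinearMap) := by
  have h1 := hf.fderiv_restrictScalars ℝ
  have h2 : e.det (fun j => fderiv ℝ f x (e j)) =
      e.det (((fderiv ℂ f x).toLinearMap.restrictScalars ℝ) ∘ e) := by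
    rw [h1]; rfl
  rw [h2, Module.Basis.det_comp, Module.Basis.det_self, mul_one, LinearMap.det_restrictScalars,
    Algebra.norm_complex_apply]

theorem rouche_nondeg {U : Set E} (hU : IsOpen U) (hUb : Bornology.IsBounded U) {f g : E → E}
    (hfc : ContinuousOn f (closure U)) (hgc : ContinuousOn g (closure U))
    (hf : DifferentiableOn ℂ f U) (hg : DifferentiableOn ℂ g U)
    (hbound : ∀ x ∈ frontier U, ‖g x‖ < ‖f x‖) {x₀ : E} (hx₀ : x₀ ∈ U) (hfx : f x₀ = 0)
    (hdet : LinearMap.det (fderiv ℂ f x₀).toLinearMap ≠ 0)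
    (hno : ∀ x ∈ closure U, f x + g x ≠ 0) : False := by
  have : ProperSpace E := FiniteDimensional.proper ℂ E
  let _ : MeasurableSpace E := borel E
  have : BorelSpace E := ⟨rfl⟩
  let μ : Measure E := Measure.addHaar
  let e := Module.finBasis ℝ E
  have hUc : IsCompact (closure U) := hUb.isCompact_closure
  have hFs : frontier U ⊆ closure U := frontier_subset_closure
  have hFc : IsCompact (frontier U) := hUc.of_isClosed_subset isClosed_frontier hFs
  obtain ⟨c, hc, hcl⟩ := hUc.exists_forall_le' (hfc.add hgc).norm (a := 0)
    (fun x hx => norm_pos_iff.2 (hno x hx))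
  obtain ⟨c2, hc2, hcl2⟩ := hFc.exists_forall_le'
    (f := fun x => ‖f x‖ - ‖g x‖) ((hfc.mono hFs).norm.sub (hgc.mono hFs).norm) (a := 0)
    (fun x hx => sub_pos.2 (hbound x hx))
  obtain ⟨M, hM⟩ := hFc.exists_bound_of_continuousOn (hgc.mono hFs)
  obtain ⟨η, hη, hηM⟩ : ∃ η : ℝ, 0 < η ∧ η * |M| ≤ c2 / 2 := by
    refine ⟨c2 / 2 / (|M| + 1), by positivity, ?_⟩
    rw [div_mul_eq_mul_div, div_le_iff₀ (by positivity)]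
    nlinarith [abs_nonneg M]
  have hlow : ∀ x ∈ frontier U, ∀ t ∈ Icc (-η) (1 + η), c2 / 2 ≤ ‖f x + t • g x‖ := by
    intro x hx t ht
    have h1 : ‖f x‖ ≤ ‖f x + t • g x‖ + ‖t • g x‖ := by
      calc ‖f x‖ = ‖(f x + t • g x) - t • g x‖ := by congr 1; abel
        _ ≤ _ := norm_sub_le _ _
    have h2 : ‖t • g x‖ ≤ (1 + η) * ‖g x‖ := by
      rw [norm_smul]
      refine mul_le_mul_of_nonneg_right ?_ (norm_nonneg _)
      rw [Real.norm_eq_abs, abs_le]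
      exact ⟨by linarith [ht.1], ht.2⟩
    have h3 : η * ‖g x‖ ≤ η * |M| :=
      mul_le_mul_of_nonneg_left ((hM x hx).trans (le_abs_self M)) hη.le
    have h4 := hcl2 x hx
    linarith
  obtain ⟨ρ, hρ, hρc, hρc2⟩ : ∃ ρ : ℝ, 0 < ρ ∧ ρ < c ∧ ρ < c2 / 2 := by
    obtain ⟨ρ, h1, h2⟩ := exists_between (lt_min hc (half_pos hc2))
    exact ⟨ρ, h1, h2.trans_le (min_le_left _ _), h2.trans_le (min_le_right _ _)⟩
  let φ : ContDiffBump (0 : E) := ⟨ρ / 2, ρ, by positivity, by linarith⟩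
  have hφs : tsupport φ = closedBall 0 ρ := φ.tsupport_eq
  let S : Set (ℝ × E) := (Icc (-η) (1 + η) ×ˢ closure U) ∩
    (fun p : ℝ × E => ‖f p.2 + p.1 • g p.2‖) ⁻¹' Iic ρ
  have hSc : IsCompact S := by
    have h0 : IsCompact (Icc (-η) (1 + η) ×ˢ closure U) := isCompact_Icc.prod hUc
    refine h0.of_isClosed_subset (ContinuousOn.preimage_isClosed_of_isClosed ?_ h0.isClosed
      isClosed_Iic) inter_subset_left
    have c2 : ContinuousOn (fun p : ℝ × E => p.2) (Icc (-η) (1 + η) ×ˢ closure U) :=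
      continuous_snd.continuousOn
    have m2 : MapsTo (fun p : ℝ × E => p.2) (Icc (-η) (1 + η) ×ˢ closure U) (closure U) :=
      fun p hp => hp.2
    exact ((hfc.comp c2 m2).add (continuous_fst.continuousOn.smul (hgc.comp c2 m2))).norm
  let K : Set E := Prod.snd '' S
  have hK : IsCompact K := hSc.image continuous_snd
  have hKU : K ⊆ U := by
    rintro _ ⟨⟨t, x⟩, ⟨⟨ht, hx⟩, hle⟩, rfl⟩
    by_contra hxU
    have hxf : x ∈ frontier U := by
      rw [hU.frontier_eq]; exact ⟨hx, hxU⟩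
    have := hlow x hxf t ht
    have h2 : ‖f x + t • g x‖ ≤ ρ := hle
    linarith
  have hmemK : ∀ t ∈ Icc (-η) (1 + η), ∀ x ∈ U, ‖f x + t • g x‖ ≤ ρ → x ∈ K :=
    fun t ht x hx hle => ⟨(t, x), ⟨⟨ht, subset_closure hx⟩, hle⟩, rfl⟩
  have hfR : ContDiffOn ℝ 2 f U := (osg hU 2 hf).restrict_scalars ℝ
  have hgR : ContDiffOn ℝ 2 g U := (osg hU 2 hg).restrict_scalars ℝ
  have hdeg := deg_inv e μ hU hK hKU hfR hgR (φ := φ) φ.contDiff hη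
    (by
      intro t ht x hx hsup
      rw [hφs, mem_closedBall_zero_iff] at hsup
      exact hmemK t (Ioo_subset_Icc_self ht) x hx hsup)
  have hR : ∫ x in K, φ (f x + g x) *
      e.det (fun j => fderiv ℝ f x (e j) + fderiv ℝ g x (e j)) ∂μ = 0 := by
    rw [setIntegral_congr_fun (g := fun _ => (0:ℝ)) hK.measurableSet, integral_zero]
    intro x hx
    have : f x + g x ∉ tsupport φ := by
      rw [hφs, mem_closedBall_zero_iff, not_le]
      exact hρc.trans_le (hcl x (subset_closure (hKU hx)))
    simp [image_eq_zero_of_notMem_tsupport this]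
  have hda : ∀ x ∈ U, DifferentiableAt ℂ f x := fun x hx =>
    (hf x hx).differentiableAt (hU.mem_nhds hx)
  have hcd : ContinuousOn (fun x => e.det (fun j => fderiv ℝ f x (e j))) U :=
    (det_cont e).comp_continuousOn (continuousOn_pi.2 fun j =>
      (hfR.continuousOn_fderiv_of_isOpen hU (by norm_num)).clm_apply continuousOn_const)
  have hL : 0 < ∫ x in K, φ (f x) * e.det (fun j => fderiv ℝ f x (e j)) ∂μ := by
    rw [setIntegral_pos_iff_support_of_nonneg_ae]
    · have hx1 : ContinuousAt (fun x => e.det (fun j => fderiv ℝ f x (e j))) x₀ :=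
        hcd.continuousAt (hU.mem_nhds hx₀)
      have hx2 : e.det (fun j => fderiv ℝ f x₀ (e j)) ≠ 0 := by
        rw [det_eq_normSq e f x₀ (hda x₀ hx₀)]
        simpa using hdet
      have hx3 : ∀ᶠ x in 𝓝 x₀, ‖f x‖ < ρ := by
        have : ContinuousAt (fun x => ‖f x‖) x₀ := (hda x₀ hx₀).continuousAt.norm
        exact this.eventually_lt continuousAt_const (by simpa [hfx] using hρ)
      have hW : (Function.support (fun x => φ (f x) * e.det (fun j => fderiv ℝ f x (e j)))) ∩ K
          ∈ 𝓝 x₀ := by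
        filter_upwards [hx1.eventually_ne hx2, hx3, hU.mem_nhds hx₀] with x h1 h2 h3
        refine ⟨mul_ne_zero (φ.pos_of_mem_ball ?_).ne' h1, ?_⟩
        · simpa using h2
        · exact hmemK 0 ⟨by linarith, by linarith⟩ x h3 (by simpa using h2.le)
      exact Measure.measure_pos_of_mem_nhds μ hW
    · filter_upwards [ae_restrict_mem hK.measurableSet] with x hx
      rw [det_eq_normSq e f x (hda x (hKU hx))]
      exact mul_nonneg φ.nonneg (Complex.normSq_nonneg _)
    · refine ContinuousOn.integrableOn_compact hK ?_
      exact (φ.continuous.comp_continuousOn (hf.continuousOn.mono hKU)).mul (hcd.mono hKU)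
  rw [hdeg, hR] at hL
  exact lt_irrefl _ hL

end final

/-- Consequence of the several-variables Rouché theorem: if `f, g` are continuous on the
closure of a bounded domain `U ⊂ ℂⁿ`, holomorphic on `U`, and `‖f x‖ > ‖g x‖` (Euclidean
norm) at every boundary point `x ∈ ∂U`, and `f` has a zero in `U`, then `f + g` has a zero
in `U`. -/
theorem rouche_several_variables (n : ℕ) (U : Set (EuclideanSpace ℂ (Fin n)))
    (hUopen : IsOpen U) (hUconn : IsConnected U) (hUbdd : Bornology.IsBounded U)
    (f g : EuclideanSpace ℂ (Fin n) → EuclideanSpace ℂ (Fin n))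
    (hfc : ContinuousOn f (closure U)) (hgc : ContinuousOn g (closure U))
    (hf : DifferentiableOn ℂ f U) (hg : DifferentiableOn ℂ g U)
    (hbound : ∀ x ∈ frontier U, ‖g x‖ < ‖f x‖)
    (hzero : ∃ x ∈ U, f x = 0) :
    ∃ x ∈ U, f x + g x = 0 := by
  by_contra hcon
  push Not at hcon
  obtain ⟨x₀, hx₀, hfx⟩ := hzero
  have hUc : IsCompact (closure U) := hUbdd.isCompact_closure
  have hFs : frontier U ⊆ closure U := frontier_subset_closure
  have hFc : IsCompact (frontier U) := hUc.of_isClosed_subset isClosed_frontier hFs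
  have hno : ∀ x ∈ closure U, f x + g x ≠ 0 := by
    intro x hx h0
    by_cases hxU : x ∈ U
    · exact hcon x hxU h0
    · have hxf : x ∈ frontier U := by
        rw [hUopen.frontier_eq]; exact ⟨hx, hxU⟩
      have := hbound x hxf
      rw [eq_neg_of_add_eq_zero_left h0, norm_neg] at this
      exact lt_irrefl _ this
  obtain ⟨c, hc, hcl⟩ := hUc.exists_forall_le' (hfc.add hgc).norm (a := 0)
    (fun x hx => norm_pos_iff.2 (hno x hx))
  obtain ⟨c2, hc2, hcl2⟩ := hFc.exists_forall_le'
    (f := fun x => ‖f x‖ - ‖g x‖) ((hfc.mono hFs).norm.sub (hgc.mono hFs).norm) (a := 0)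
    (fun x hx => sub_pos.2 (hbound x hx))
  obtain ⟨D, hD⟩ := hUc.exists_bound_of_continuousOn
    (f := fun x => x - x₀) (by fun_prop)
  have hD0 : 0 ≤ D := (norm_nonneg _).trans (hD x₀ (subset_closure hx₀))
  have hm : 0 < min c c2 := lt_min hc hc2
  set A : Module.End ℂ (EuclideanSpace ℂ (Fin n)) := (fderiv ℂ f x₀).toLinearMap with hA
  have hfin : {ε : ℝ | A.HasEigenvalue (-(ε : ℂ))}.Finite :=
    (Module.End.finite_hasEigenvalue A).preimage
      (fun a _ b _ h => Complex.ofReal_injective (neg_injective h))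
  obtain ⟨ε, ⟨hε0, hε1⟩, hεA⟩ := (Ioo_infinite (show (0:ℝ) < min c c2 / (D + 1) by
    positivity)).exists_notMem_finite hfin
  have hεD : ε * D < min c c2 := by
    rw [lt_div_iff₀ (by positivity)] at hε1
    linarith
  have hsm : ∀ x ∈ closure U, ‖(ε : ℂ) • (x - x₀)‖ < min c c2 := by
    intro x hx
    rw [norm_smul, Complex.norm_real, Real.norm_eq_abs, abs_of_pos hε0]
    exact (mul_le_mul_of_nonneg_left (hD x hx) hε0.le).trans_lt hεD
  have hdl : ∀ x, HasFDerivAt (fun x => (ε : ℂ) • (x - x₀))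
      ((ε : ℂ) • ContinuousLinearMap.id ℂ (EuclideanSpace ℂ (Fin n))) x := fun x =>
    ((hasFDerivAt_id x).sub_const x₀).const_smul (ε : ℂ)
  refine rouche_nondeg (f := fun x => f x + (ε : ℂ) • (x - x₀)) (g := g) hUopen hUbdd
    (hfc.add (by fun_prop)) hgc (hf.add fun x _ => (hdl x).differentiableAt.differentiableWithinAt)
    hg ?_ hx₀ (by simp [hfx]) ?_ ?_
  · intro x hx
    have h1 := hsm x (hFs hx)
    have h2 : c2 ≤ ‖f x‖ - ‖g x‖ := hcl2 x hx
    have h3 : ‖f x‖ ≤ ‖f x + (ε : ℂ) • (x - x₀)‖ + ‖(ε : ℂ) • (x - x₀)‖ := by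
      calc ‖f x‖ = ‖(f x + (ε : ℂ) • (x - x₀)) - (ε : ℂ) • (x - x₀)‖ := by congr 1; abel
        _ ≤ _ := norm_sub_le _ _
    linarith [min_le_right c c2]
  · intro h0
    apply hεA
    have hfd : fderiv ℂ (fun x => f x + (ε : ℂ) • (x - x₀)) x₀ = fderiv ℂ f x₀ +
        (ε : ℂ) • ContinuousLinearMap.id ℂ (EuclideanSpace ℂ (Fin n)) :=
      (((hf x₀ hx₀).differentiableAt (hUopen.mem_nhds hx₀)).hasFDerivAt.add (hdl x₀)).fderiv
    rw [hfd] at h0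
    obtain ⟨v, hv, hv0⟩ := (Submodule.ne_bot_iff _).1 (LinearMap.bot_lt_ker_of_det_eq_zero h0).ne'
    have hv1 : fderiv ℂ f x₀ v + (ε : ℂ) • v = 0 := hv
    refine Module.End.hasEigenvalue_of_hasEigenvector (x := v) ⟨?_, hv0⟩
    rw [Module.End.mem_eigenspace_iff, neg_smul]
    exact eq_neg_of_add_eq_zero_left hv1
  · intro x hx h0
    have h1 := hsm x hx
    have h2 : c ≤ ‖f x + g x‖ := hcl x hx
    have h3 : f x + g x = -((ε : ℂ) • (x - x₀)) := by
      rw [eq_neg_iff_add_eq_zero, ← h0]; abel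
    rw [h3, norm_neg] at h2
    linarith [min_le_left c c2]
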